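/- For every integer n ≥ 2 one has the raising ladder identity of polynomials q_{3,n}(x) S_{n−1}(x) + q_{0,n}(x) S_{n−1}′(x) = q_{4,n}(x) S_n(x); moreover, for n ≥ d+1, deg q_{0,n} = 2d+2, deg q_{3,n} = 2d+1 and deg q_{4,n} = 2d. -/

import Mathlib

open Polynomial MeasureTheory Finset

noncomputable section

/-- The `k`-th derivative of a real polynomial. -/
def iterDeriv (k : ℕ) (f : Polynomial ℝ) : Polynomial ℝ := Polynomial.derivative^[k] f

/-- The Jacobi measure `dμ^{α,β}(x) = (1-x)^α (1+x)^β dx` on `[-1,1]`. -/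
def jacobiMeasure (α β : ℝ) : Measure ℝ :=
  (volume.restrict (Set.Icc (-1 : ℝ) 1)).withDensity
    fun x => ENNReal.ofReal ((1 - x) ^ α * (1 + x) ^ β)

/-- The Jacobi–Sobolev inner product
`⟨f,g⟩_S = ∫ f g dμ^{α,β} + ∑_{j=1}^N ∑_{k=0}^{d_j} λ_{j,k} f^{(k)}(c_j) g^{(k)}(c_j)`. -/
def sobolevIP (α β : ℝ) {N : ℕ} (c : Fin N → ℝ) (dd : Fin N → ℕ)
    (lam : Fin N → ℕ → ℝ) (f g : Polynomial ℝ) : ℝ :=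
  (∫ x, f.eval x * g.eval x ∂(jacobiMeasure α β)) +
    ∑ j : Fin N, ∑ k ∈ Finset.range (dd j + 1),
      lam j k * (iterDeriv k f).eval (c j) * (iterDeriv k g).eval (c j)

/-- The degree-`k` Taylor polynomial of `f` centred at `c`:
`Q_k(x,c;f) = ∑_{ν=0}^k f^{(ν)}(c)(x-c)^ν/ν!` (as a polynomial in `x`). -/
def taylorPoly (k : ℕ) (c : ℝ) (f : Polynomial ℝ) : Polynomial ℝ :=
  ∑ ν ∈ Finset.range (k + 1),
    Polynomial.C ((iterDeriv ν f).eval c / Nat.factorial ν) * (X - Polynomial.C c) ^ ν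

/-- `ρ(x) = ∏_{j=1}^N (x-c_j)^{d_j+1}`. -/
def rhoPoly {N : ℕ} (c : Fin N → ℝ) (dd : Fin N → ℕ) : Polynomial ℝ :=
  ∏ j : Fin N, (X - Polynomial.C (c j)) ^ (dd j + 1)

/-- `ρ_{j,k}(x) = ρ(x)/(x-c_j)^{k+1} = (x-c_j)^{d_j-k} ∏_{i≠j} (x-c_i)^{d_i+1}`. -/
def rhoJK {N : ℕ} (c : Fin N → ℝ) (dd : Fin N → ℕ) (j : Fin N) (k : ℕ) : Polynomial ℝ :=
  (X - Polynomial.C (c j)) ^ (dd j - k) *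
    ∏ i ∈ Finset.univ.erase j, (X - Polynomial.C (c i)) ^ (dd i + 1)

/-- `â_n(x) = -n((2n+α+β)x+β-α)/(2n+α+β)`. -/
def ahat (α β : ℝ) (n : ℕ) : Polynomial ℝ :=
  Polynomial.C (-(n : ℝ) / (2 * (n : ℝ) + α + β)) *
    (Polynomial.C (2 * (n : ℝ) + α + β) * X + Polynomial.C (β - α))

/-- `b̂_n = 4n(n+α)(n+β)(n+α+β)/((2n+α+β)²(2n+α+β-1))`. -/
def bhat (α β : ℝ) (n : ℕ) : ℝ :=
  4 * (n : ℝ) * ((n : ℝ) + α) * ((n : ℝ) + β) * ((n : ℝ) + α + β) /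
    ((2 * (n : ℝ) + α + β) ^ 2 * (2 * (n : ℝ) + α + β - 1))

/-- `ĉ_n(x) = (n+α+β)((2n+α+β)x+α-β)/(2n+α+β)`. -/
def chat (α β : ℝ) (n : ℕ) : Polynomial ℝ :=
  Polynomial.C (((n : ℝ) + α + β) / (2 * (n : ℝ) + α + β)) *
    (Polynomial.C (2 * (n : ℝ) + α + β) * X + Polynomial.C (α - β))

/-- `d̂_n = -(2n+α+β-1)`. -/
def dhat (α β : ℝ) (n : ℕ) : ℝ := -(2 * (n : ℝ) + α + β - 1)

/-- `γ_{1,n} = (β²-α²)/((2n+α+β)(2n+α+β+2))`. -/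
def gamma1 (α β : ℝ) (n : ℕ) : ℝ :=
  (β ^ 2 - α ^ 2) / ((2 * (n : ℝ) + α + β) * (2 * (n : ℝ) + α + β + 2))

/-- `γ_{2,n} = 4n(n+α)(n+β)(n+α+β)/((2n+α+β)²((2n+α+β)²-1))`. -/
def gamma2 (α β : ℝ) (n : ℕ) : ℝ :=
  4 * (n : ℝ) * ((n : ℝ) + α) * ((n : ℝ) + β) * ((n : ℝ) + α + β) /
    ((2 * (n : ℝ) + α + β) ^ 2 * ((2 * (n : ℝ) + α + β) ^ 2 - 1))

/-- The density of the Jacobi measure. -/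
def jacobiWeight (α β x : ℝ) : ℝ := (1 - x) ^ α * (1 + x) ^ β

lemma measurable_jacobiWeight (α β : ℝ) : Measurable (jacobiWeight α β) := by
  unfold jacobiWeight
  fun_prop

lemma integrableOn_jacobiWeight {α β : ℝ} (hα : -1 < α) (hβ : -1 < β) :
    IntegrableOn (jacobiWeight α β) (Set.Icc (-1) 1) := by
  have hl : IntervalIntegrable (jacobiWeight α β) volume (-1) 0 := by
    have h1 : IntervalIntegrable (fun x : ℝ => (1 + x) ^ β) volume (-1) 0 := by
      have := (intervalIntegral.intervalIntegrable_rpow' (a := 0) (b := 1) hβ).comp_add_left 1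
      simpa using this
    refine h1.continuousOn_mul ?_
    intro x hx
    rw [Set.uIcc_of_le (by norm_num)] at hx
    refine ContinuousAt.continuousWithinAt ?_
    refine ContinuousAt.rpow_const (by fun_prop) (Or.inl ?_)
    linarith [hx.2]
  have hr : IntervalIntegrable (jacobiWeight α β) volume 0 1 := by
    have h1 : IntervalIntegrable (fun x : ℝ => (1 - x) ^ α) volume 0 1 := by
      have := (intervalIntegral.intervalIntegrable_rpow' (a := 1) (b := 0) hα).comp_sub_left 1
      simpa using this
    refine h1.mul_continuousOn ?_
    intro x hx
    rw [Set.uIcc_of_le (by norm_num)] at hx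
    refine ContinuousAt.continuousWithinAt ?_
    refine ContinuousAt.rpow_const (by fun_prop) (Or.inl ?_)
    linarith [hx.1]
  have := hl.trans hr
  rwa [intervalIntegrable_iff_integrableOn_Icc_of_le (by norm_num)] at this

lemma jacobiWeight_nonneg {α β x : ℝ} (hx : x ∈ Set.Icc (-1 : ℝ) 1) : 0 ≤ jacobiWeight α β x :=
  mul_nonneg (Real.rpow_nonneg (by linarith [hx.2]) _) (Real.rpow_nonneg (by linarith [hx.1]) _)

lemma jacobiWeight_pos {α β x : ℝ} (hx : x ∈ Set.Ioo (-1 : ℝ) 1) : 0 < jacobiWeight α β x :=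
  mul_pos (Real.rpow_pos_of_pos (by linarith [hx.2]) _)
    (Real.rpow_pos_of_pos (by linarith [hx.1]) _)

lemma jacobiMeasure_eq (α β : ℝ) : jacobiMeasure α β =
    (volume.restrict (Set.Icc (-1 : ℝ) 1)).withDensity
      fun x => ENNReal.ofReal (jacobiWeight α β x) := rfl

lemma integrable_jacobiMeasure {α β : ℝ} (hα : -1 < α) (hβ : -1 < β) (p : ℝ[X]) :
    Integrable (fun x => p.eval x) (jacobiMeasure α β) := by
  rw [jacobiMeasure_eq, integrable_withDensity_iff_integrable_smul'
    (measurable_jacobiWeight α β).ennreal_ofReal (by simp)]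
  have h1 : IntegrableOn (fun x => jacobiWeight α β x * p.eval x) (Set.Icc (-1) 1) :=
    (integrableOn_jacobiWeight hα hβ).mul_continuousOn p.continuous.continuousOn isCompact_Icc
  refine h1.congr ?_
  filter_upwards [ae_restrict_mem measurableSet_Icc] with x hx
  simp [ENNReal.toReal_ofReal (jacobiWeight_nonneg hx)]

lemma integral_jacobiMeasure (α β : ℝ) (f : ℝ → ℝ) :
    ∫ x, f x ∂(jacobiMeasure α β) = ∫ x in Set.Icc (-1 : ℝ) 1, jacobiWeight α β x * f x := by
  rw [jacobiMeasure_eq, integral_withDensity_eq_integral_toReal_smul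
    (measurable_jacobiWeight α β).ennreal_ofReal (by simp)]
  refine setIntegral_congr_fun measurableSet_Icc fun x hx => ?_
  simp [ENNReal.toReal_ofReal (jacobiWeight_nonneg hx)]

/-- Integration against the Jacobi measure as a linear functional on polynomials. -/
def jacobiFunctional {α β : ℝ} (hα : -1 < α) (hβ : -1 < β) : ℝ[X] →ₗ[ℝ] ℝ where
  toFun p := ∫ x, p.eval x ∂(jacobiMeasure α β)
  map_add' p q := by
    simp only [eval_add]
    exact integral_add (integrable_jacobiMeasure hα hβ p) (integrable_jacobiMeasure hα hβ q)
  map_smul' a p := by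
    simp only [eval_smul, smul_eq_mul, RingHom.id_apply]
    exact integral_const_mul a _

lemma jacobiFunctional_mul_self_pos {α β : ℝ} (hα : -1 < α) (hβ : -1 < β) {p : ℝ[X]}
    (hp : p ≠ 0) : 0 < jacobiFunctional hα hβ (p * p) := by
  change 0 < ∫ x, (p * p).eval x ∂(jacobiMeasure α β)
  rw [integral_pos_iff_support_of_nonneg (fun x => by simpa using mul_self_nonneg (p.eval x))
    (integrable_jacobiMeasure hα hβ _), pos_iff_ne_zero, jacobiMeasure_eq, Ne,
    withDensity_apply_eq_zero' (measurable_jacobiWeight α β).ennreal_ofReal.aemeasurable]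
  intro h0
  have h1 : volume (Set.Ioo (-1 : ℝ) 1 \ (p.roots.toFinset : Set ℝ)) = 0 := by
    rw [Measure.restrict_apply' measurableSet_Icc] at h0
    refine measure_mono_null ?_ h0
    rintro x ⟨hx, hr⟩
    refine ⟨⟨?_, ?_⟩, Set.Ioo_subset_Icc_self hx⟩
    · simpa using jacobiWeight_pos hx
    · simpa [hp] using hr
  rw [measure_sdiff_null (p.roots.toFinset.finite_toSet.measure_zero _)] at h1
  norm_num at h1

lemma jacobiFunctional_first_moment {α β : ℝ} (hα : -1 < α) (hβ : -1 < β) :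
    jacobiFunctional hα hβ (C (β - α) - C (α + β + 2) * X) = 0 := by
  change ∫ x, _ ∂(jacobiMeasure α β) = 0
  rw [integral_jacobiMeasure, integral_Icc_eq_integral_Ioc,
    ← intervalIntegral.integral_of_le (by norm_num)]
  have hcont : ContinuousOn (fun x : ℝ => (1 - x) ^ (α + 1) * (1 + x) ^ (β + 1))
      (Set.Icc (-1) 1) := by
    refine Continuous.continuousOn (Continuous.mul ?_ ?_)
    · exact Continuous.rpow_const (by fun_prop) fun x => Or.inr (by linarith)
    · exact Continuous.rpow_const (by fun_prop) fun x => Or.inr (by linarith)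
  rw [intervalIntegral.integral_eq_sub_of_hasDerivAt_of_le (by norm_num) hcont]
  · have h1 : α + 1 ≠ 0 := by linarith
    have h2 : β + 1 ≠ 0 := by linarith
    simp [Real.zero_rpow h1, Real.zero_rpow h2]
  · intro x hx
    have h1 : 0 < 1 - x := by linarith [hx.2]
    have h2 : 0 < 1 + x := by linarith [hx.1]
    have e1 := ((hasDerivAt_id x).const_sub 1).rpow_const (p := α + 1) (Or.inl h1.ne')
    have e2 := ((hasDerivAt_id x).const_add 1).rpow_const (p := β + 1) (Or.inl h2.ne')
    refine (e1.mul e2).congr_deriv ?_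
    simp only [jacobiWeight, id, Real.rpow_add_one h1.ne', Real.rpow_add_one h2.ne',
      add_sub_cancel_right, eval_sub, eval_mul, eval_C, eval_X]
    ring
  · rw [intervalIntegrable_iff_integrableOn_Icc_of_le (by norm_num)]
    exact (integrableOn_jacobiWeight hα hβ).mul_continuousOn
      (Polynomial.continuous _).continuousOn isCompact_Icc

/-- The polynomial `p` has degree at most `n` and its coefficient of `X ^ n` is `a`. -/
def HasTop (p : ℝ[X]) (n : ℕ) (a : ℝ) : Prop := p.natDegree ≤ n ∧ p.coeff n = a

namespace HasTop

variable {p q : ℝ[X]} {m n : ℕ} {a b : ℝ}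

lemma add (hp : HasTop p n a) (hq : HasTop q n b) : HasTop (p + q) n (a + b) :=
  ⟨natDegree_add_le_of_degree_le hp.1 hq.1, by rw [coeff_add, hp.2, hq.2]⟩

lemma sub (hp : HasTop p n a) (hq : HasTop q n b) : HasTop (p - q) n (a - b) :=
  ⟨natDegree_sub_le_of_le hp.1 hq.1 |>.trans (by simp), by rw [coeff_sub, hp.2, hq.2]⟩

lemma mul (hp : HasTop p m a) (hq : HasTop q n b) : HasTop (p * q) (m + n) (a * b) :=
  ⟨natDegree_mul_le_of_le hp.1 hq.1, by rw [coeff_mul_add_eq_of_natDegree_le hp.1 hq.1, hp.2, hq.2]⟩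

lemma const (a : ℝ) : HasTop (C a) 0 a := ⟨by simp, by simp⟩

lemma linear (a b : ℝ) : HasTop (C a * X + C b) 1 a := ⟨natDegree_linear_le, by simp [coeff_C]⟩

lemma X_sub_C (a : ℝ) : HasTop (X - C a) 1 1 := ⟨natDegree_X_sub_C_le a, by simp⟩

lemma C_mul (c : ℝ) (hp : HasTop p n a) : HasTop (C c * p) n (c * a) := by
  simpa using (const c).mul hp

lemma of_lt (hp : p.natDegree < n) : HasTop p n 0 := ⟨hp.le, coeff_eq_zero_of_natDegree_lt hp⟩

lemma lift (hp : HasTop p n a) (h : n < m) : HasTop p m 0 := of_lt (hp.1.trans_lt h)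

lemma of_monic (hp : p.Monic) (hn : p.natDegree = n) : HasTop p n 1 :=
  ⟨hn.le, by rw [← hn]; exact hp⟩

lemma sum {ι : Type*} (s : Finset ι) {f : ι → ℝ[X]} {g : ι → ℝ}
    (h : ∀ i ∈ s, HasTop (f i) n (g i)) : HasTop (∑ i ∈ s, f i) n (∑ i ∈ s, g i) :=
  ⟨natDegree_sum_le_of_forall_le s f fun i hi => (h i hi).1, by
    rw [finsetSum_coeff]; exact Finset.sum_congr rfl fun i hi => (h i hi).2⟩

lemma one_sub_sq : HasTop (1 - X ^ 2 : ℝ[X]) 2 (-1) := by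
  refine ⟨by compute_degree, ?_⟩
  simp [coeff_one]

lemma one_sub_sq_mul_derivative (hp : HasTop p n a) :
    HasTop ((1 - X ^ 2) * derivative p) (n + 1) (-(n * a)) := by
  cases n with
  | zero =>
    rw [derivative_of_natDegree_zero (Nat.le_zero.1 hp.1)]
    simp [HasTop]
  | succ n =>
    have hd : HasTop (derivative p) n (a * (n + 1)) :=
      ⟨(natDegree_derivative_le p).trans (by have := hp.1; omega), by
        rw [coeff_derivative, hp.2]⟩
    have := one_sub_sq.mul hd
    convert this using 1
    · omega
    · push_cast; ring

lemma natDegree_eq (hp : HasTop p n a) (ha : a ≠ 0) : p.natDegree = n :=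
  natDegree_eq_of_le_of_coeff_ne_zero hp.1 (by rwa [hp.2])

lemma of_monic_mul (hp : p.Monic) (hm : p.natDegree = m) (h : HasTop (p * q) (m + n) a) :
    HasTop q n a := by
  have hq : q.natDegree ≤ n := by
    by_cases hq0 : q = 0
    · simp [hq0]
    have := h.1
    rw [hp.natDegree_mul' hq0, hm] at this
    omega
  refine ⟨hq, ?_⟩
  rw [← h.2, ((of_monic hp hm).mul (n := n) ⟨hq, rfl⟩).2, one_mul]

end HasTop

lemma iterDeriv_eval (k : ℕ) (x : ℝ) (f : ℝ[X]) :
    (iterDeriv k f).eval x = (k.factorial : ℝ) * (taylor x f).coeff k := by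
  rw [taylor_coeff, iterDeriv, ← factorial_smul_hasseDeriv]
  simp

lemma taylorPoly_eq (k : ℕ) (x : ℝ) (f : ℝ[X]) : taylorPoly k x f =
    ∑ ν ∈ range (k + 1), C ((taylor x f).coeff ν) * (X - C x) ^ ν := by
  refine Finset.sum_congr rfl fun ν _ => ?_
  rw [iterDeriv_eval, mul_div_cancel_left₀ _ (by positivity)]

lemma hasTop_X_sub_C_pow (x : ℝ) (k : ℕ) : HasTop ((X - C x) ^ k) k 1 :=
  HasTop.of_monic ((monic_X_sub_C x).pow k) (by simp)

lemma hasTop_taylorPoly (k : ℕ) (x : ℝ) (f : ℝ[X]) :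
    HasTop (taylorPoly k x f) k ((taylor x f).coeff k) := by
  rw [taylorPoly_eq, Finset.sum_range_succ]
  have h1 : HasTop (∑ ν ∈ range k, C ((taylor x f).coeff ν) * (X - C x) ^ ν) k
      (∑ ν ∈ range k, (0 : ℝ)) :=
    HasTop.sum _ fun ν hν => ((hasTop_X_sub_C_pow x ν).C_mul _).lift (Finset.mem_range.1 hν)
  simpa using h1.add ((hasTop_X_sub_C_pow x k).C_mul ((taylor x f).coeff k))

section Rho

variable {N : ℕ} (c : Fin N → ℝ) (dd : Fin N → ℕ)

lemma rhoPoly_monic : (rhoPoly c dd).Monic :=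
  monic_prod_of_monic _ _ fun _ _ => (monic_X_sub_C _).pow _

lemma natDegree_rhoPoly : (rhoPoly c dd).natDegree = ∑ j, (dd j + 1) := by
  rw [rhoPoly, natDegree_prod_of_monic _ _ fun _ _ => (monic_X_sub_C _).pow _]
  simp

lemma X_sub_C_pow_mul_rhoJK (j : Fin N) {k : ℕ} (hk : k ≤ dd j) :
    (X - C (c j)) ^ (k + 1) * rhoJK c dd j k = rhoPoly c dd := by
  rw [rhoJK, rhoPoly, ← Finset.mul_prod_erase _ _ (Finset.mem_univ j), ← mul_assoc, ← pow_add]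
  congr 2
  omega

lemma hasTop_rhoJK (j : Fin N) {k e : ℕ} (hk : k ≤ dd j) (he : k + e + 1 = ∑ j, (dd j + 1)) :
    HasTop (rhoJK c dd j k) e 1 := by
  refine HasTop.of_monic_mul ((monic_X_sub_C (c j)).pow (k + 1)) (m := k + 1) (by simp) ?_
  rw [X_sub_C_pow_mul_rhoJK c dd j hk]
  exact HasTop.of_monic (rhoPoly_monic c dd) (by rw [natDegree_rhoPoly]; omega)

end Rho

lemma linearMap_C_mul (L : ℝ[X] →ₗ[ℝ] ℝ) (a : ℝ) (p : ℝ[X]) : L (C a * p) = a * L p := by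
  rw [← smul_eq_C_mul, map_smul, smul_eq_mul]

/-- Monic orthogonal polynomials for a linear functional on real polynomials. -/
structure IsMonicOrthogonal (L : ℝ[X] →ₗ[ℝ] ℝ) (P : ℕ → ℝ[X]) : Prop where
  monic : ∀ m, (P m).Monic
  natDegree_eq : ∀ m, (P m).natDegree = m
  orthogonal : ∀ m l, m ≠ l → L (P m * P l) = 0

lemma exists_eq_sum_of_monic {P : ℕ → ℝ[X]} (hm : ∀ m, (P m).Monic)
    (hd : ∀ m, (P m).natDegree = m) (n : ℕ) (q : ℝ[X]) (hq : q.degree < n) :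
    ∃ a : ℕ → ℝ, q = ∑ i ∈ range n, C (a i) * P i := by
  induction n generalizing q with
  | zero => exact ⟨0, by simpa using hq⟩
  | succ n ih =>
    have hP : (P n).coeff n = 1 := by
      have := hm n
      rwa [Monic, leadingCoeff, hd n] at this
    obtain ⟨a, ha⟩ := ih (q - C (q.coeff n) * P n) (by
      rw [degree_lt_iff_coeff_zero] at hq ⊢
      intro k hk
      rcases hk.eq_or_lt with rfl | hk
      · simp [hP]
      · rw [coeff_sub, coeff_C_mul, hq k hk, coeff_eq_zero_of_natDegree_lt ((hd n).trans_lt hk)]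
        simp)
    refine ⟨fun i => if i = n then q.coeff n else a i, ?_⟩
    simp only [Finset.sum_range_succ, if_true]
    rw [← sub_eq_iff_eq_add, ha]
    refine Finset.sum_congr rfl fun i hi => ?_
    rw [if_neg (Finset.mem_range.1 hi).ne]

lemma degree_sub_lt_of_monic {p q : ℝ[X]} {n : ℕ} (hp : p.Monic) (hq : q.Monic)
    (hpn : p.natDegree = n) (hqn : q.natDegree = n) : (p - q).degree < n := by
  have hp' : p.degree = n := by rw [degree_eq_natDegree hp.ne_zero, hpn]
  have hq' : q.degree = n := by rw [degree_eq_natDegree hq.ne_zero, hqn]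
  rw [← hp']
  exact degree_sub_lt_left (hp'.trans hq'.symm) hp.ne_zero (hp.trans hq.symm)

namespace IsMonicOrthogonal

variable {L : ℝ[X] →ₗ[ℝ] ℝ} {P : ℕ → ℝ[X]}

lemma zero_eq (hP : IsMonicOrthogonal L P) : P 0 = 1 :=
  (hP.monic 0).natDegree_eq_zero.1 (hP.natDegree_eq 0)

lemma map_mul_of_degree_lt (hP : IsMonicOrthogonal L P) {n : ℕ} {q : ℝ[X]} (hq : q.degree < n) :
    L (P n * q) = 0 := by
  obtain ⟨a, rfl⟩ := exists_eq_sum_of_monic hP.monic hP.natDegree_eq n q hq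
  rw [Finset.mul_sum, map_sum]
  refine Finset.sum_eq_zero fun i hi => ?_
  rw [mul_left_comm, linearMap_C_mul, hP.orthogonal n i (Finset.mem_range.1 hi).ne', mul_zero]

lemma map_mul_of_monic (hP : IsMonicOrthogonal L P) {n : ℕ} {q : ℝ[X]} (hq : q.Monic)
    (hqn : q.natDegree = n) : L (P n * q) = L (P n * P n) := by
  have := hP.map_mul_of_degree_lt (degree_sub_lt_of_monic hq (hP.monic n) hqn (hP.natDegree_eq n))
  rwa [mul_sub, map_sub, sub_eq_zero] at this

lemma eq_sum (hP : IsMonicOrthogonal L P) (h0 : ∀ i, L (P i * P i) ≠ 0) {n : ℕ} {q : ℝ[X]}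
    (hq : q.degree < n) : q = ∑ i ∈ range n, C (L (P i * q) / L (P i * P i)) * P i := by
  obtain ⟨a, ha⟩ := exists_eq_sum_of_monic hP.monic hP.natDegree_eq n q hq
  conv_lhs => rw [ha]
  refine Finset.sum_congr rfl fun i hi => ?_
  congr 2
  rw [eq_div_iff (h0 i), ha, Finset.mul_sum, map_sum, Finset.sum_eq_single i]
  · rw [mul_left_comm, linearMap_C_mul]
  · intro l _ hl
    rw [mul_left_comm, linearMap_C_mul, hP.orthogonal i l hl.symm, mul_zero]
  · exact fun h => absurd hi h

/-- The last recurrence coefficient is a ratio of consecutive square norms. -/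
lemma gamma_mul_norm (hP : IsMonicOrthogonal L P) {n : ℕ} {a b : ℝ}
    (hrec : X * P (n + 1) = P (n + 2) + C a * P (n + 1) + C b * P n) :
    b * L (P n * P n) = L (P (n + 1) * P (n + 1)) := by
  have h1 : L (X * P (n + 1) * P n) = L (P (n + 1) * P (n + 1)) := by
    rw [show X * P (n + 1) * P n = P (n + 1) * (X * P n) by ring]
    refine hP.map_mul_of_monic (monic_X.mul (hP.monic n)) ?_
    rw [monic_X.natDegree_mul (hP.monic n), natDegree_X, hP.natDegree_eq, add_comm]
  rw [hrec, add_mul, add_mul, mul_assoc, mul_assoc, map_add, map_add, linearMap_C_mul, linearMap_C_mul,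
    hP.orthogonal _ _ (by omega), hP.orthogonal _ _ (by omega)] at h1
  simpa using h1

/-- A Christoffel–Darboux type identity: `f` and `g` are coefficient sequences (in a second
variable) compatible with the three-term recurrence of `P`. -/
lemma christoffelDarboux_of_recurrence {h γ₁ γ₂ f g : ℕ → ℝ} {x a : ℝ}
    (hP0 : P 0 = 1) (hP1 : P 1 = X - C a)
    (hrec : ∀ m, X * P (m + 1) = P (m + 2) + C (γ₁ (m + 1)) * P (m + 1) + C (γ₂ (m + 1)) * P m)
    (hγ : ∀ m, γ₂ (m + 1) * h m = h (m + 1)) (h0 : ∀ m, h m ≠ 0)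
    (hf0 : x * f 0 + g 0 = f 1 + a * f 0)
    (hf : ∀ m, x * f (m + 1) + g (m + 1) =
      f (m + 2) + γ₁ (m + 1) * f (m + 1) + γ₂ (m + 1) * f m) (n : ℕ) :
    (X - C x) * ∑ i ∈ range (n + 1), C (f i / h i) * P i =
      ∑ i ∈ range (n + 1), C (g i / h i) * P i +
        C (1 / h n) * (C (f n) * P (n + 1) - C (f (n + 1)) * P n) := by
  induction n with
  | zero =>
    have hg : g 0 = f 1 + a * f 0 - x * f 0 := by linarith
    simp only [zero_add, Finset.sum_range_one, hP0, hP1, hg, div_eq_mul_inv, one_mul, C_mul,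
      C_sub, C_add, mul_one]
    ring
  | succ n ih =>
    have hg : g (n + 1) = f (n + 2) + γ₁ (n + 1) * f (n + 1) + γ₂ (n + 1) * f n
      - x * f (n + 1) := by linarith [hf n]
    have hinv : (h n)⁻¹ = γ₂ (n + 1) * (h (n + 1))⁻¹ := by
      have := h0 n
      have := h0 (n + 1)
      rw [← hγ n] at this ⊢
      field_simp
      rw [div_self (left_ne_zero_of_mul this)]
    have hP2 : P (n + 1 + 1) = X * P (n + 1) - C (γ₁ (n + 1)) * P (n + 1)
      - C (γ₂ (n + 1)) * P n := by rw [hrec n]; ring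
    rw [Finset.sum_range_succ, mul_add, ih, Finset.sum_range_succ _ (n + 1), hP2, hg]
    simp only [div_eq_mul_inv, one_mul, C_mul, C_sub, C_add, hinv]
    ring

/-- Christoffel–Darboux identity for the kernel differentiated `k` times in its second variable. -/
lemma christoffelDarboux {h γ₁ γ₂ : ℕ → ℝ} {a : ℝ}
    (hP0 : P 0 = 1) (hP1 : P 1 = X - C a)
    (hrec : ∀ m, X * P (m + 1) = P (m + 2) + C (γ₁ (m + 1)) * P (m + 1) + C (γ₂ (m + 1)) * P m)
    (hγ : ∀ m, γ₂ (m + 1) * h m = h (m + 1)) (h0 : ∀ m, h m ≠ 0) (x : ℝ) (n k : ℕ) :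
    (X - C x) ^ (k + 1) * ∑ i ∈ range (n + 1), C ((taylor x (P i)).coeff k / h i) * P i =
      C (1 / h n) * (taylorPoly k x (P n) * P (n + 1) - taylorPoly k x (P (n + 1)) * P n) := by
  have hT0 : (X + C x) * taylor x (P 0) = taylor x (P 1) + C a * taylor x (P 0) := by
    rw [hP1, hP0, taylor_one, map_sub, taylor_X, taylor_C]; simp
  have hT : ∀ m, (X + C x) * taylor x (P (m + 1)) = taylor x (P (m + 2)) +
      C (γ₁ (m + 1)) * taylor x (P (m + 1)) + C (γ₂ (m + 1)) * taylor x (P m) := by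
    intro m
    have := congrArg (taylor x) (hrec m)
    simpa only [taylor_mul, taylor_X, map_add, taylor_C] using this
  induction k with
  | zero =>
    have key := christoffelDarboux_of_recurrence (x := x) (f := fun i => (taylor x (P i)).coeff 0)
      (g := fun _ => 0) hP0 hP1 hrec hγ h0
      (by simpa [add_mul, mul_coeff_zero] using congrArg (coeff · 0) hT0)
      (fun m => by simpa [add_mul, mul_coeff_zero] using congrArg (coeff · 0) (hT m)) n
    simpa [taylorPoly_eq] using key
  | succ k ih =>
    have key := christoffelDarboux_of_recurrence (x := x) (f := fun i => (taylor x (P i)).coeff (k + 1))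
      (g := fun i => (taylor x (P i)).coeff k) hP0 hP1 hrec hγ h0
      (by simpa only [add_mul, coeff_add, coeff_C_mul, coeff_X_mul, add_comm]
            using congrArg (coeff · (k + 1)) hT0)
      (fun m => by
        have := congrArg (coeff · (k + 1)) (hT m)
        simp only [add_mul, coeff_add, coeff_C_mul, coeff_X_mul] at this
        linarith) n
    rw [pow_succ, mul_assoc, key, mul_add, ih]
    simp only [taylorPoly_eq, Finset.sum_range_succ _ (k + 1)]
    ring

end IsMonicOrthogonal

section JacobiStructure

variable {α β : ℝ} {P : ℕ → ℝ[X]}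

lemma jacobi_denominators (hα : -1 < α) (hβ : -1 < β) (h : α + β + 1 ≠ 0) (m : ℕ) :
    ∃ t : ℝ, α = t - 2 * (m + 1) - β ∧ t ≠ 0 ∧ t + 1 ≠ 0 ∧ t + 2 ≠ 0 ∧ t - 1 ≠ 0 ∧
      2 * ((m : ℝ) + 1) + α + β = t ∧ 2 * ((m : ℝ) + 2) + α + β = t + 2 := by
  have hm : (0 : ℝ) ≤ m := m.cast_nonneg
  refine ⟨2 * (m + 1) + α + β, by ring, by linarith, by linarith, by linarith, ?_, rfl, by ring⟩
  rcases m with _ | m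
  · intro h4
    apply h
    push_cast at h4
    linarith
  · have : (0 : ℝ) ≤ m := m.cast_nonneg
    push_cast
    linarith

lemma ahat_eq (hα : -1 < α) (hβ : -1 < β) (h : α + β + 1 ≠ 0) (m : ℕ) : ahat α β (m + 1) =
    chat α β (m + 2) + C (dhat α β (m + 2)) * (X - C (gamma1 α β (m + 1))) := by
  obtain ⟨t, ht, h0, h1, h2, h3, e1, e2⟩ := jacobi_denominators hα hβ h m
  refine Polynomial.funext fun x => ?_
  simp only [ahat, chat, dhat, gamma1, eval_add, eval_mul, eval_sub, eval_C, eval_X]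
  push_cast
  rw [e1, e2, ht]
  field_simp
  ring

lemma bhat_eq (hα : -1 < α) (hβ : -1 < β) (h : α + β + 1 ≠ 0) (m : ℕ) :
    bhat α β (m + 1) = -dhat α β (m + 2) * gamma2 α β (m + 1) := by
  obtain ⟨t, ht, h0, h1, h2, h3, e1, e2⟩ := jacobi_denominators hα hβ h m
  simp only [bhat, dhat, gamma2]
  push_cast
  rw [e1, e2, ht, show t ^ 2 - 1 = (t - 1) * (t + 1) by ring]
  field_simp
  ring

lemma bhat_mul_sub (hα : -1 < α) (hβ : -1 < β) (h : α + β + 1 ≠ 0) (m : ℕ) :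
    (X - C (gamma1 α β (m + 1))) * C (bhat α β (m + 1)) - C (gamma2 α β (m + 1)) * chat α β (m + 1)
      = -C (gamma2 α β (m + 1)) * ahat α β (m + 2) := by
  obtain ⟨t, ht, h0, h1, h2, h3, e1, e2⟩ := jacobi_denominators hα hβ h m
  rw [bhat_eq hα hβ h]
  refine Polynomial.funext fun x => ?_
  have key : -(x - gamma1 α β (m + 1)) * dhat α β (m + 2) - (chat α β (m + 1)).eval x
      = -(ahat α β (m + 2)).eval x := by
    simp only [ahat, chat, dhat, gamma1, eval_add, eval_mul, eval_C, eval_X]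
    push_cast
    rw [e1, e2, ht]
    field_simp
    ring
  simp only [eval_mul, eval_sub, eval_neg, eval_C, eval_X]
  linear_combination gamma2 α β (m + 1) * key

lemma ahat_mul_sub (hα : -1 < α) (hβ : -1 < β) (h : α + β + 1 ≠ 0) (m : ℕ) :
    1 - X ^ 2 + (X - C (gamma1 α β (m + 1))) * ahat α β (m + 1)
        - C (gamma2 α β (m + 1)) * C (dhat α β (m + 1))
      = ahat α β (m + 2) * (X - C (gamma1 α β (m + 1))) + C (bhat α β (m + 2)) := by
  obtain ⟨t, ht, h0, h1, h2, h3, e1, e2⟩ := jacobi_denominators hα hβ h m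
  refine Polynomial.funext fun x => ?_
  simp only [ahat, bhat, dhat, gamma1, gamma2, eval_add, eval_mul, eval_sub, eval_C, eval_X,
    eval_one, eval_pow]
  push_cast
  rw [e1, e2, ht, show t ^ 2 - 1 = (t - 1) * (t + 1) by ring,
    show t + 2 - 1 = t + 1 by ring]
  field_simp
  ring

/-- The Jacobi structure relations, in raising and lowering form. -/
lemma jacobi_structure (hα : -1 < α) (hβ : -1 < β) (h : α + β + 1 ≠ 0)
    (hP0 : P 0 = 1) (hP1 : P 1 = X - C ((β - α) / (α + β + 2)))
    (hrec : ∀ m, X * P (m + 1) = P (m + 2) + C (gamma1 α β (m + 1)) * P (m + 1) +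
      C (gamma2 α β (m + 1)) * P m) (m : ℕ) :
    (1 - X ^ 2) * derivative (P m) =
        chat α β (m + 1) * P m + C (dhat α β (m + 1)) * P (m + 1) ∧
      (1 - X ^ 2) * derivative (P (m + 1)) =
        ahat α β (m + 1) * P (m + 1) + C (bhat α β (m + 1)) * P m := by
  induction m with
  | zero =>
    have h1 : α + β + 2 ≠ 0 := by linarith
    have h1' : 2 + α + β ≠ 0 := by linarith
    have h2 : 2 + α + β - 1 ≠ 0 := fun h2 => h (by linarith)
    constructor
    · refine Polynomial.funext fun x => ?_
      simp only [zero_add, hP0, hP1, chat, dhat, derivative_one, eval_add, eval_mul, eval_sub,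
        eval_C, eval_X, eval_one, eval_zero]
      push_cast
      field_simp
      ring
    · refine Polynomial.funext fun x => ?_
      simp only [zero_add, hP0, hP1, ahat, bhat, derivative_sub, derivative_X, derivative_C,
        eval_add, eval_mul, eval_sub, eval_C, eval_X, eval_one, eval_zero, eval_pow]
      push_cast
      rw [mul_one, mul_one]
      field_simp
      ring
  | succ m ih =>
    obtain ⟨hR, hL⟩ := ih
    have hP : P (m + 2) = (X - C (gamma1 α β (m + 1))) * P (m + 1) -
      C (gamma2 α β (m + 1)) * P m := by rw [sub_mul, hrec]; ring
    constructor
    · rw [hL, ahat_eq hα hβ h, bhat_eq hα hβ h, hP]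
      simp only [C_mul, C_neg]
      ring
    · have hd : derivative (P (m + 2)) = P (m + 1) + (X - C (gamma1 α β (m + 1))) *
          derivative (P (m + 1)) - C (gamma2 α β (m + 1)) * derivative (P m) := by
        rw [hP]
        simp
      change (1 - X ^ 2) * derivative (P (m + 2)) =
        ahat α β (m + 2) * P (m + 2) + C (bhat α β (m + 2)) * P (m + 1)
      rw [hd, hP]
      linear_combination (X - C (gamma1 α β (m + 1))) * hL - C (gamma2 α β (m + 1)) * hR +
        P (m + 1) * ahat_mul_sub hα hβ h m + P m * bhat_mul_sub hα hβ h m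

lemma jacobi_one_eq (hα : -1 < α) (hβ : -1 < β)
    (hP : IsMonicOrthogonal (jacobiFunctional hα hβ) P) :
    P 1 = X - C ((β - α) / (α + β + 2)) := by
  have h2 : α + β + 2 ≠ 0 := by linarith
  have hP1 : P 1 = X + C ((P 1).coeff 0) := (hP.monic 1).eq_X_add_C (hP.natDegree_eq 1)
  set b := (P 1).coeff 0
  have h1 := jacobiFunctional_first_moment hα hβ
  have h3 : (C (β - α) - C (α + β + 2) * X : ℝ[X]) =
      C (β - α + (α + β + 2) * b) * (1 * 1) - C (α + β + 2) * (P 1 * P 0) := by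
    rw [hP1, hP.zero_eq]; simp only [C_add, C_mul]; ring
  rw [h3, map_sub, linearMap_C_mul, linearMap_C_mul,
    hP.orthogonal 1 0 one_ne_zero, mul_zero, sub_zero] at h1
  have h4 := (mul_eq_zero.1 h1).resolve_right
    (jacobiFunctional_mul_self_pos hα hβ one_ne_zero).ne'
  have h5 : b = -((β - α) / (α + β + 2)) := by field_simp; linarith
  rw [hP1, h5, C_neg, ← sub_eq_add_neg]

end JacobiStructure

section Sobolev

variable {α β : ℝ} {N : ℕ} {c : Fin N → ℝ} {dd : Fin N → ℕ} {lam : Fin N → ℕ → ℝ}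

/-- The Jacobi–Sobolev inner product as a linear functional of its first argument. -/
def sobolevFunctional (hα : -1 < α) (hβ : -1 < β) (c : Fin N → ℝ) (dd : Fin N → ℕ)
    (lam : Fin N → ℕ → ℝ) (g : ℝ[X]) : ℝ[X] →ₗ[ℝ] ℝ :=
  jacobiFunctional hα hβ ∘ₗ LinearMap.mulRight ℝ g +
    ∑ j : Fin N, ∑ k ∈ range (dd j + 1),
      (lam j k * (iterDeriv k g).eval (c j) * k.factorial) • (lcoeff ℝ k ∘ₗ taylor (c j))

lemma sobolevFunctional_apply (hα : -1 < α) (hβ : -1 < β) (f g : ℝ[X]) :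
    sobolevFunctional hα hβ c dd lam g f = jacobiFunctional hα hβ (f * g) +
      ∑ j : Fin N, ∑ k ∈ range (dd j + 1),
        lam j k * (iterDeriv k g).eval (c j) * k.factorial * (taylor (c j) f).coeff k := by
  simp [sobolevFunctional, LinearMap.sum_apply]

lemma sobolevFunctional_eq (hα : -1 < α) (hβ : -1 < β) (f g : ℝ[X]) :
    sobolevFunctional hα hβ c dd lam g f = sobolevIP α β c dd lam f g := by
  rw [sobolevFunctional_apply, sobolevIP]
  simp only [iterDeriv_eval]
  congr 1
  · simp [jacobiFunctional]
  · refine Finset.sum_congr rfl fun j _ => Finset.sum_congr rfl fun k _ => ?_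
    ring

lemma sobolevFunctional_self_pos (hα : -1 < α) (hβ : -1 < β) (hlam : ∀ j k, 0 ≤ lam j k)
    {f : ℝ[X]} (hf : f ≠ 0) : 0 < sobolevFunctional hα hβ c dd lam f f := by
  rw [sobolevFunctional_apply]
  refine add_pos_of_pos_of_nonneg (jacobiFunctional_mul_self_pos hα hβ hf)
    (Finset.sum_nonneg fun j _ => Finset.sum_nonneg fun k _ => ?_)
  rw [mul_assoc, ← iterDeriv_eval, mul_assoc]
  exact mul_nonneg (hlam j k) (mul_self_nonneg _)

lemma sobolevFunctional_eq_zero (hα : -1 < α) (hβ : -1 < β) {g q : ℝ[X]} {m : ℕ}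
    (hg : ∀ l < m, sobolevIP α β c dd lam (X ^ l) g = 0) (hq : q.degree < m) :
    sobolevFunctional hα hβ c dd lam g q = 0 := by
  obtain ⟨a, rfl⟩ := exists_eq_sum_of_monic (P := fun l => X ^ l) (fun l => monic_X_pow l)
    (fun l => natDegree_X_pow l) m q hq
  rw [map_sum]
  refine Finset.sum_eq_zero fun l hl => ?_
  rw [linearMap_C_mul, sobolevFunctional_eq, hg l (Finset.mem_range.1 hl), mul_zero]

end Sobolev

section Connection

variable {α β : ℝ} {N : ℕ} {c : Fin N → ℝ} {dd : Fin N → ℕ} {lam : Fin N → ℕ → ℝ}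
  {P : ℕ → ℝ[X]} {h : ℕ → ℝ} {g : ℝ[X]} {n : ℕ}

lemma sobolev_sub_eq (hα : -1 < α) (hβ : -1 < β)
    (hP : IsMonicOrthogonal (jacobiFunctional hα hβ) P)
    (hh : ∀ i, h i = jacobiFunctional hα hβ (P i * P i)) (h0 : ∀ i, h i ≠ 0)
    (hgm : g.Monic) (hgn : g.natDegree = n)
    (hgo : ∀ l < n, sobolevIP α β c dd lam (X ^ l) g = 0) :
    g - P n = -∑ j : Fin N, ∑ k ∈ range (dd j + 1),
      C (lam j k * (iterDeriv k g).eval (c j) * k.factorial) *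
        ∑ i ∈ range n, C ((taylor (c j) (P i)).coeff k / h i) * P i := by
  rw [hP.eq_sum (fun i => by rw [← hh]; exact h0 i)
    (degree_sub_lt_of_monic hgm (hP.monic n) hgn (hP.natDegree_eq n))]
  have hi : ∀ i ∈ range n, jacobiFunctional hα hβ (P i * (g - P n)) =
      -∑ j : Fin N, ∑ k ∈ range (dd j + 1),
        lam j k * (iterDeriv k g).eval (c j) * k.factorial * (taylor (c j) (P i)).coeff k := by
    intro i hi
    have hdeg : (P i).degree < n := by
      rw [degree_eq_natDegree (hP.monic i).ne_zero, hP.natDegree_eq]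
      exact_mod_cast Finset.mem_range.1 hi
    have h1 := sobolevFunctional_eq_zero hα hβ hgo hdeg
    rw [sobolevFunctional_apply] at h1
    rw [mul_sub, map_sub, hP.orthogonal i n (Finset.mem_range.1 hi).ne, sub_zero]
    exact eq_neg_of_add_eq_zero_left h1
  rw [Finset.sum_congr rfl fun i hi' => by rw [hi i hi', ← hh]]
  simp only [Finset.mul_sum]
  rw [Finset.sum_congr rfl fun j _ => Finset.sum_comm, Finset.sum_comm, ← Finset.sum_neg_distrib]
  refine Finset.sum_congr rfl fun i _ => ?_
  simp only [neg_div, C_neg, neg_mul, Finset.sum_div, map_sum, Finset.sum_mul]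
  congr 1
  refine Finset.sum_congr rfl fun j _ => Finset.sum_congr rfl fun k _ => ?_
  simp only [div_eq_mul_inv, C_mul]
  ring

/-- The connection formula expressing `ρ S_n` through two consecutive Jacobi polynomials. -/
lemma rhoPoly_mul_eq (hα : -1 < α) (hβ : -1 < β)
    (hP : IsMonicOrthogonal (jacobiFunctional hα hβ) P)
    (hh : ∀ i, h i = jacobiFunctional hα hβ (P i * P i)) (h0 : ∀ i, h i ≠ 0)
    (hrec : ∀ m, X * P (m + 1) = P (m + 2) + C (gamma1 α β (m + 1)) * P (m + 1) +
      C (gamma2 α β (m + 1)) * P m)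
    (hgm : g.Monic) (hgn : g.natDegree = n + 1)
    (hgo : ∀ l < n + 1, sobolevIP α β c dd lam (X ^ l) g = 0) :
    rhoPoly c dd * g =
      (rhoPoly c dd - ∑ j : Fin N, ∑ k ∈ range (dd j + 1),
        C ((k.factorial : ℝ) * lam j k * (iterDeriv k g).eval (c j) / h n) *
          (taylorPoly k (c j) (P n) * rhoJK c dd j k)) * P (n + 1) +
      (∑ j : Fin N, ∑ k ∈ range (dd j + 1),
        C ((k.factorial : ℝ) * lam j k * (iterDeriv k g).eval (c j) / h n) *
          (taylorPoly k (c j) (P (n + 1)) * rhoJK c dd j k)) * P n := by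
  have hsub := sobolev_sub_eq hα hβ hP hh h0 hgm hgn hgo
  have hterm : ∀ j : Fin N, ∀ k ∈ range (dd j + 1),
      rhoPoly c dd * (C (lam j k * (iterDeriv k g).eval (c j) * k.factorial) *
        ∑ i ∈ range (n + 1), C ((taylor (c j) (P i)).coeff k / h i) * P i) =
      C ((k.factorial : ℝ) * lam j k * (iterDeriv k g).eval (c j) / h n) *
          (taylorPoly k (c j) (P n) * rhoJK c dd j k) * P (n + 1) -
      C ((k.factorial : ℝ) * lam j k * (iterDeriv k g).eval (c j) / h n) *
          (taylorPoly k (c j) (P (n + 1)) * rhoJK c dd j k) * P n := by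
    intro j k hk
    have hk' : k ≤ dd j := Nat.lt_succ_iff.1 (Finset.mem_range.1 hk)
    have hCD := IsMonicOrthogonal.christoffelDarboux hP.zero_eq (jacobi_one_eq hα hβ hP) hrec
      (fun m => by rw [hh, hh]; exact hP.gamma_mul_norm (hrec m)) h0 (c j) n k
    rw [← X_sub_C_pow_mul_rhoJK c dd j hk', mul_right_comm, mul_left_comm _ (C _), hCD]
    simp only [div_eq_mul_inv, C_mul, one_mul]
    ring
  have hsum : rhoPoly c dd * (g - P (n + 1)) =
      -∑ j : Fin N, ∑ k ∈ range (dd j + 1),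
      (C ((k.factorial : ℝ) * lam j k * (iterDeriv k g).eval (c j) / h n) *
          (taylorPoly k (c j) (P n) * rhoJK c dd j k) * P (n + 1) -
      C ((k.factorial : ℝ) * lam j k * (iterDeriv k g).eval (c j) / h n) *
          (taylorPoly k (c j) (P (n + 1)) * rhoJK c dd j k) * P n) := by
    rw [hsub, mul_neg, Finset.mul_sum]
    congr 1
    refine Finset.sum_congr rfl fun j _ => ?_
    rw [Finset.mul_sum]
    exact Finset.sum_congr rfl (hterm j)
  simp only [Finset.sum_sub_distrib, ← Finset.sum_mul] at hsum
  linear_combination hsum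

lemma hasTop_taylor_sum (q : ℝ[X]) (w : Fin N → ℕ → ℝ) {e : ℕ} (he : ∑ j, (dd j + 1) = e + 1) :
    HasTop (∑ j : Fin N, ∑ k ∈ range (dd j + 1),
        C (w j k) * (taylorPoly k (c j) q * rhoJK c dd j k)) e
      (∑ j : Fin N, ∑ k ∈ range (dd j + 1), w j k * (taylor (c j) q).coeff k) := by
  refine HasTop.sum _ fun j _ => HasTop.sum _ fun k hk => HasTop.C_mul _ ?_
  have hk' : k ≤ dd j := Nat.lt_succ_iff.1 (Finset.mem_range.1 hk)
  have hle : dd j + 1 ≤ e + 1 :=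
    he ▸ Finset.single_le_sum (f := fun j => dd j + 1) (fun _ _ => Nat.zero_le _)
      (Finset.mem_univ j)
  have := (hasTop_taylorPoly k (c j) q).mul
    (hasTop_rhoJK c dd j hk' (e := e - k) (by rw [he]; omega))
  rwa [mul_one, Nat.add_sub_cancel' (by omega)] at this

lemma sobolev_leading_sum (hα : -1 < α) (hβ : -1 < β)
    (hP : IsMonicOrthogonal (jacobiFunctional hα hβ) P)
    (hh : ∀ i, h i = jacobiFunctional hα hβ (P i * P i)) (h0 : ∀ i, h i ≠ 0)
    (hgm : g.Monic) (hgn : g.natDegree = n + 1)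
    (hgo : ∀ l < n + 1, sobolevIP α β c dd lam (X ^ l) g = 0) :
    h (n + 1) + h n * ∑ j : Fin N, ∑ k ∈ range (dd j + 1),
      (k.factorial : ℝ) * lam j k * (iterDeriv k g).eval (c j) / h n *
        (taylor (c j) (P (n + 1))).coeff k = sobolevFunctional hα hβ c dd lam g g := by
  have h1 := sobolevFunctional_eq_zero hα hβ hgo
    (degree_sub_lt_of_monic hgm (hP.monic (n + 1)) hgn (hP.natDegree_eq (n + 1)))
  rw [map_sub, sub_eq_zero] at h1
  rw [h1, sobolevFunctional_apply, hP.map_mul_of_monic hgm hgn, ← hh, Finset.mul_sum]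
  congr 1
  refine Finset.sum_congr rfl fun j _ => ?_
  rw [Finset.mul_sum]
  refine Finset.sum_congr rfl fun k _ => ?_
  have := h0 n
  field_simp

end Connection

lemma hasTop_ahat {α β : ℝ} {n : ℕ} (h : 2 * (n : ℝ) + α + β ≠ 0) :
    HasTop (ahat α β n) 1 (-n) := by
  have := (HasTop.linear (2 * (n : ℝ) + α + β) (β - α)).C_mul (-(n : ℝ) / (2 * (n : ℝ) + α + β))
  rwa [div_mul_cancel₀ _ h] at this

lemma hasTop_chat {α β : ℝ} {n : ℕ} (h : 2 * (n : ℝ) + α + β ≠ 0) :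
    HasTop (chat α β n) 1 (n + α + β) := by
  have := (HasTop.linear (2 * (n : ℝ) + α + β) (α - β)).C_mul
    (((n : ℝ) + α + β) / (2 * (n : ℝ) + α + β))
  rwa [div_mul_cancel₀ _ h] at this

theorem stmt13 (α β : ℝ) (hα : -1 < α) (hβ : -1 < β)
    (N : ℕ) (hN : 1 ≤ N)
    (c : Fin N → ℝ) (hc : Function.Injective c) (hcout : ∀ j, c j ∉ Set.Ioo (-1 : ℝ) 1)
    (dd : Fin N → ℕ) (hdd : Monotone dd)
    (lam : Fin N → ℕ → ℝ) (hlam : ∀ j k, 0 ≤ lam j k) (hlamd : ∀ j, 0 < lam j (dd j))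
    (d : ℕ) (hd : d = ∑ j, (dd j + 1))
    (P : ℕ → Polynomial ℝ) (hPm : ∀ m, (P m).Monic) (hPd : ∀ m, (P m).natDegree = m)
    (hPo : ∀ m l, m ≠ l → ∫ x, (P m).eval x * (P l).eval x ∂(jacobiMeasure α β) = 0)
    (h : ℕ → ℝ) (hh : ∀ m, h m = ∫ x, ((P m).eval x) ^ 2 ∂(jacobiMeasure α β))
    (S : ℕ → Polynomial ℝ) (hSm : ∀ m, (S m).Monic) (hSd : ∀ m, (S m).natDegree = m)
    (hSo : ∀ m l, l < m → sobolevIP α β c dd lam (X ^ l) (S m) = 0)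
    (A2 B2 : ℕ → Polynomial ℝ)
    (hA2 : ∀ m, 1 ≤ m → A2 m = rhoPoly c dd -
      ∑ j : Fin N, ∑ k ∈ Finset.range (dd j + 1),
        Polynomial.C ((Nat.factorial k : ℝ) * lam j k * (iterDeriv k (S m)).eval (c j) / h (m - 1)) *
          (taylorPoly k (c j) (P (m - 1)) * rhoJK c dd j k))
    (hB2 : ∀ m, 1 ≤ m → B2 m =
      ∑ j : Fin N, ∑ k ∈ Finset.range (dd j + 1),
        Polynomial.C ((Nat.factorial k : ℝ) * lam j k * (iterDeriv k (S m)).eval (c j) / h (m - 1)) *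
          (taylorPoly k (c j) (P m) * rhoJK c dd j k))
    (A3 B3 : ℕ → Polynomial ℝ)
    (hA3 : ∀ m, 1 ≤ m → A3 m = (1 - X ^ 2) * Polynomial.derivative (A2 m) +
      ahat α β m * A2 m + Polynomial.C (dhat α β m) * B2 m)
    (hB3 : ∀ m, 1 ≤ m → B3 m = (1 - X ^ 2) * Polynomial.derivative (B2 m) +
      Polynomial.C (bhat α β m) * A2 m + chat α β m * B2 m)
    (hrec : ∀ m, 1 ≤ m → X * P m =
      P (m + 1) + Polynomial.C (gamma1 α β m) * P m + Polynomial.C (gamma2 α β m) * P (m - 1))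
    (C2 D2 : ℕ → Polynomial ℝ)
    (hC2 : ∀ m, 2 ≤ m → C2 m = Polynomial.C (-(1 / gamma2 α β (m - 1))) * B2 (m - 1))
    (hD2 : ∀ m, 2 ≤ m → D2 m = A2 (m - 1) +
      Polynomial.C (1 / gamma2 α β (m - 1)) * B2 (m - 1) * (X - Polynomial.C (gamma1 α β (m - 1))))
    (C3 D3 : ℕ → Polynomial ℝ)
    (hC3 : ∀ m, 2 ≤ m → C3 m = Polynomial.C (-(1 / gamma2 α β (m - 1))) * B3 (m - 1))
    (hD3 : ∀ m, 2 ≤ m → D3 m = A3 (m - 1) +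
      Polynomial.C (1 / gamma2 α β (m - 1)) * B3 (m - 1) * (X - Polynomial.C (gamma1 α β (m - 1))))
    (δ : ℕ → Polynomial ℝ)
    (hδ : ∀ m, 2 ≤ m → A2 m * D2 m - B2 m * C2 m = rhoPoly c dd * δ m)
    (q0 : ℕ → Polynomial ℝ)
    (hq0 : ∀ m, 2 ≤ m → q0 m = (1 - X ^ 2) * (A2 m * D2 m - B2 m * C2 m))
    (q3 q4 : ℕ → Polynomial ℝ)
    (hq3 : ∀ m, 2 ≤ m → q3 m = (1 - X ^ 2) * Polynomial.derivative (rhoPoly c dd) * δ m +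
      C3 m * B2 m - D3 m * A2 m)
    (hq4 : ∀ m, 2 ≤ m → q4 m = C3 m * D2 m - D3 m * C2 m)
    (n : ℕ) (hn : 2 ≤ n) :
    q3 n * S (n - 1) + q0 n * Polynomial.derivative (S (n - 1)) = q4 n * S n ∧
      (d + 1 ≤ n → (q0 n).natDegree = 2 * d + 2 ∧ (q3 n).natDegree = 2 * d + 1 ∧
        (q4 n).natDegree = 2 * d) := by
  obtain ⟨m, rfl⟩ : ∃ m, n = m + 2 := ⟨n - 2, by omega⟩
  have hP : IsMonicOrthogonal (jacobiFunctional hα hβ) P :=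
    ⟨hPm, hPd, fun m l hml => by
      rw [← hPo m l hml]; simp [jacobiFunctional]⟩
  have hh' : ∀ i, h i = jacobiFunctional hα hβ (P i * P i) := fun i => by
    rw [hh]; simp [jacobiFunctional, sq]
  have hpos : ∀ i, 0 < h i := fun i => by
    rw [hh']; exact jacobiFunctional_mul_self_pos hα hβ (hPm i).ne_zero
  have h0 : ∀ i, h i ≠ 0 := fun i => (hpos i).ne'
  have hrec' : ∀ m, X * P (m + 1) = P (m + 2) + C (gamma1 α β (m + 1)) * P (m + 1) +
      C (gamma2 α β (m + 1)) * P m := fun m => hrec (m + 1) (by omega)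
  have hγ : ∀ m, gamma2 α β (m + 1) * h m = h (m + 1) := fun m => by
    rw [hh', hh']; exact hP.gamma_mul_norm (hrec' m)
  have hγ0 : ∀ m, gamma2 α β (m + 1) ≠ 0 := fun m hz => h0 (m + 1) (by rw [← hγ, hz, zero_mul])
  have hαβ : α + β + 1 ≠ 0 := by
    intro hz
    refine hγ0 0 ?_
    simp only [gamma2, zero_add, Nat.cast_one]
    rw [show 1 + α + β = 0 by linarith]
    simp
  obtain ⟨hR, hL⟩ := jacobi_structure hα hβ hαβ hP.zero_eq (jacobi_one_eq hα hβ hP) hrec' m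
  have hgo : ∀ m, ∀ l < m, sobolevIP α β c dd lam (X ^ l) (S m) = 0 := fun m l => hSo m l
  have hconn : ∀ m, rhoPoly c dd * S (m + 1) = A2 (m + 1) * P (m + 1) + B2 (m + 1) * P m := by
    intro m
    rw [hA2 (m + 1) (by omega), hB2 (m + 1) (by omega)]
    exact rhoPoly_mul_eq hα hβ hP hh' h0 hrec' (hSm _) (hSd _) (hgo _)
  have hn1 : m + 2 - 1 = m + 1 := rfl
  have hc2 := hC2 (m + 2) hn
  have hd2 := hD2 (m + 2) hn
  have hc3 := hC3 (m + 2) hn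
  have hd3 := hD3 (m + 2) hn
  have ha3 := hA3 (m + 1) (by omega)
  have hb3 := hB3 (m + 1) (by omega)
  rw [hn1] at hc2 hd2 hc3 hd3
  have hinv : C (1 / gamma2 α β (m + 1)) * C (gamma2 α β (m + 1)) = (1 : ℝ[X]) := by
    rw [← C_mul, one_div_mul_cancel (hγ0 m), C_1]
  have hPm' : P m = C (1 / gamma2 α β (m + 1)) *
      (X * P (m + 1) - P (m + 2) - C (gamma1 α β (m + 1)) * P (m + 1)) := by
    rw [hrec' m]
    linear_combination -(P m) * hinv
  have E2 : rhoPoly c dd * S (m + 1) = C2 (m + 2) * P (m + 2) + D2 (m + 2) * P (m + 1) := by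
    rw [hconn, hc2, hd2, C_neg]
    linear_combination B2 (m + 1) * hPm'
  have E3' : (1 - X ^ 2) * derivative (rhoPoly c dd * S (m + 1)) =
      A3 (m + 1) * P (m + 1) + B3 (m + 1) * P m := by
    rw [hconn, ha3, hb3, derivative_add, derivative_mul, derivative_mul]
    linear_combination A2 (m + 1) * hL + B2 (m + 1) * hR
  have E3 : (1 - X ^ 2) * derivative (rhoPoly c dd * S (m + 1)) =
      C3 (m + 2) * P (m + 2) + D3 (m + 2) * P (m + 1) := by
    rw [E3', hc3, hd3, C_neg]
    linear_combination B3 (m + 1) * hPm'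
  rw [derivative_mul] at E3
  have hid : q3 (m + 2) * S (m + 1) + q0 (m + 2) * derivative (S (m + 1)) =
      q4 (m + 2) * S (m + 2) := by
    refine mul_left_cancel₀ (rhoPoly_monic c dd).ne_zero ?_
    rw [hq3 _ hn, hq0 _ hn, hq4 _ hn]
    linear_combination (A2 (m + 2) * D2 (m + 2) - B2 (m + 2) * C2 (m + 2)) * E3 +
      (C3 (m + 2) * B2 (m + 2) - D3 (m + 2) * A2 (m + 2)) * E2 -
      (C3 (m + 2) * D2 (m + 2) - D3 (m + 2) * C2 (m + 2)) * hconn (m + 1) -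
      (1 - X ^ 2) * derivative (rhoPoly c dd) * S (m + 1) * hδ (m + 2) hn
  refine ⟨hid, fun _ => ?_⟩
  obtain ⟨e, he⟩ : ∃ e, ∑ j, (dd j + 1) = e + 1 := by
    have : dd ⟨0, hN⟩ + 1 ≤ ∑ j, (dd j + 1) :=
      Finset.single_le_sum (f := fun j => dd j + 1) (fun _ _ => Nat.zero_le _)
        (Finset.mem_univ _)
    exact ⟨∑ j, (dd j + 1) - 1, by omega⟩
  rw [he] at hd
  subst hd
  have hm0 : (0 : ℝ) ≤ m := m.cast_nonneg
  have hden : 2 * ((m + 1 : ℕ) : ℝ) + α + β ≠ 0 := by push_cast; linarith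
  have hρdeg : (rhoPoly c dd).natDegree = e + 1 := by rw [natDegree_rhoPoly, he]
  have tρ : HasTop (rhoPoly c dd) (e + 1) 1 := HasTop.of_monic (rhoPoly_monic c dd) hρdeg
  have tA : ∀ m, HasTop (A2 (m + 1)) (e + 1) 1 := by
    intro m
    rw [hA2 (m + 1) (by omega)]
    simpa using tρ.sub ((hasTop_taylor_sum _ _ he).lift (Nat.lt_succ_self e))
  have tB : ∀ m, ∃ b, HasTop (B2 (m + 1)) e b ∧
      h (m + 1) + h m * b = sobolevFunctional hα hβ c dd lam (S (m + 1)) (S (m + 1)) := by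
    intro m
    refine ⟨_, ?_, sobolev_leading_sum hα hβ hP hh' h0 (hSm _) (hSd _) (hgo _)⟩
    rw [hB2 (m + 1) (by omega)]
    exact hasTop_taylor_sum _ _ he
  obtain ⟨b', tB2, -⟩ := tB (m + 1)
  obtain ⟨b, tB1, hb⟩ := tB m
  set κ : ℝ := 1 + 1 / gamma2 α β (m + 1) * b with hκ
  have hκ0 : κ ≠ 0 := by
    have h1 : h (m + 1) * κ = h (m + 1) + h m * b := by
      rw [hκ, ← hγ m]
      have := hγ0 m
      field_simp
    intro hz
    rw [hz, mul_zero, hb] at h1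
    exact (sobolevFunctional_self_pos hα hβ hlam (hSm (m + 1)).ne_zero).ne h1
  have tC2 := tB1.C_mul (-(1 / gamma2 α β (m + 1)))
  rw [← hc2] at tC2
  have tD2 : HasTop (D2 (m + 2)) (e + 1) κ := by
    rw [hd2]
    simpa [hκ] using (tA m).add ((tB1.C_mul (1 / gamma2 α β (m + 1))).mul
      (HasTop.X_sub_C (gamma1 α β (m + 1))))
  have tΔ : HasTop (A2 (m + 2) * D2 (m + 2) - B2 (m + 2) * C2 (m + 2)) (e + 1 + (e + 1)) κ := by
    simpa using ((tA (m + 1)).mul tD2).sub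
      ((tB2.mul tC2).lift (show e + e < e + 1 + (e + 1) by omega))
  have tδ : HasTop (δ (m + 2)) (e + 1) κ := by
    rw [hδ _ hn] at tΔ
    exact HasTop.of_monic_mul (rhoPoly_monic c dd) hρdeg tΔ
  have tB3 : HasTop (B3 (m + 1)) (e + 1)
      (-(e * b) + bhat α β (m + 1) * 1 + ((m + 1 : ℕ) + α + β) * b) := by
    rw [hb3]
    refine (tB1.one_sub_sq_mul_derivative.add ((tA m).C_mul _)).add ?_
    simpa only [add_comm 1 e] using (hasTop_chat hden).mul tB1
  have tA3 : HasTop (A3 (m + 1)) (e + 1 + 1)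
      (-((e + 1 : ℕ) * 1) + -((m + 1 : ℕ) : ℝ) * 1 + 0) := by
    rw [ha3]
    refine ((tA m).one_sub_sq_mul_derivative.add ?_).add
      ((tB1.C_mul _).lift (show e < e + 1 + 1 by omega))
    simpa only [add_comm 1 (e + 1)] using (hasTop_ahat hden).mul (tA m)
  have tC3 := tB3.C_mul (-(1 / gamma2 α β (m + 1)))
  rw [← hc3] at tC3
  have tD3 := tA3.add ((tB3.C_mul (1 / gamma2 α β (m + 1))).mul
      (HasTop.X_sub_C (gamma1 α β (m + 1))))
  rw [← hd3] at tD3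
  have tq0 := HasTop.one_sub_sq.mul tΔ
  rw [← hq0 _ hn] at tq0
  have tq3 : HasTop (q3 (m + 2)) (e + 1 + 1 + (e + 1)) (-((m + 2 + α + β) * κ)) := by
    have := ((tρ.one_sub_sq_mul_derivative.mul tδ).add
      ((tC3.mul tB2).lift (show e + 1 + e < e + 1 + 1 + (e + 1) by omega))).sub
      (tD3.mul (tA (m + 1)))
    rw [← hq3 _ hn] at this
    convert this using 1
    rw [bhat_eq hα hβ hαβ, dhat, hκ]
    have := hγ0 m
    push_cast
    field_simp
    ring
  have tS : HasTop (S (m + 1)) (m + 1) 1 := HasTop.of_monic (hSm _) (hSd _)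
  have tq4 : HasTop (q4 (m + 2)) (e + 1 + (e + 1)) (-((2 * m + 3 + α + β) * κ)) := by
    refine HasTop.of_monic_mul (hSm (m + 2)) (hSd (m + 2)) ?_
    rw [mul_comm, ← hid, hq0 _ hn, mul_right_comm, mul_comm _ (A2 _ * _ - _)]
    have t1 := tΔ.mul tS.one_sub_sq_mul_derivative
    have t2 := tq3.mul tS
    rw [show e + 1 + (e + 1) + (m + 1 + 1) = m + 2 + (e + 1 + (e + 1)) by omega] at t1
    rw [show e + 1 + 1 + (e + 1) + (m + 1) = m + 2 + (e + 1 + (e + 1)) by omega] at t2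
    convert t2.add t1 using 1
    push_cast
    ring
  refine ⟨?_, ?_, ?_⟩
  · rw [tq0.natDegree_eq (mul_ne_zero (by norm_num) hκ0)]
    ring
  · rw [tq3.natDegree_eq (neg_ne_zero.2 (mul_ne_zero (by linarith) hκ0))]
    ring
  · rw [tq4.natDegree_eq (neg_ne_zero.2 (mul_ne_zero (by linarith) hκ0))]
    ring
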